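/- arXiv:2510.03072 — 2 statements merged into one kernel-verified Lean document; each statement's English description precedes it below -/
import Mathlib

section
/- Let u(σ) ≥ 1 be defined for σ ≥ 0 by u(σ)² − 1 − 2·log u(σ) = σ². Then for every σ ≥ 0: max(√2·σ, σ² + log(1 + σ²)) ≤ u(σ)² − 1 ≤ √2·σ + σ². -/
/-- A lower bound for `log (1 + y)` by its second-order Taylor polynomial. -/
theorem sub_sq_half_le_log_one_add {y : ℝ} (hy : 0 ≤ y) :
    y - y ^ 2 / 2 ≤ Real.log (1 + y) := by
  refine le_trans ?_ (Real.le_log_one_add_of_nonneg hy)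
  rw [le_div_iff₀ (by positivity)]
  nlinarith [pow_nonneg hy 3]

/-- With `L = log (1 + y)`, this is `L ^ 2 / 2 ≤ exp L - 1 - L`. -/
theorem log_one_add_sq_le {y : ℝ} (hy : 0 ≤ y) :
    Real.log (1 + y) ^ 2 ≤ 2 * (y - Real.log (1 + y)) := by
  have h := Real.quadratic_le_exp_of_nonneg (Real.log_nonneg (by linarith : 1 ≤ 1 + y))
  rw [Real.exp_log (by linarith)] at h
  linarith

/-- Bounds on the implicit function `u(σ)` defined by `u² − 1 − 2·log u = σ²`:
`max(√2·σ, σ² + log(1+σ²)) ≤ u(σ)² − 1 ≤ √2·σ + σ²`. -/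
theorem u_bounds
    (u : ℝ → ℝ)
    (hu : ∀ σ : ℝ, 0 ≤ σ →
      1 ≤ u σ ∧ (u σ) ^ 2 - 1 - 2 * Real.log (u σ) = σ ^ 2) :
    ∀ σ : ℝ, 0 ≤ σ →
      max (Real.sqrt 2 * σ) (σ ^ 2 + Real.log (1 + σ ^ 2)) ≤ (u σ) ^ 2 - 1 ∧
      (u σ) ^ 2 - 1 ≤ Real.sqrt 2 * σ + σ ^ 2 := by
  intro σ hσ
  obtain ⟨h1, h2⟩ := hu σ hσ
  obtain ⟨y, hy⟩ : ∃ y, y = u σ ^ 2 - 1 := ⟨_, rfl⟩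
  have hy0 : 0 ≤ y := by nlinarith
  have hlog0 : 0 ≤ Real.log (1 + y) := Real.log_nonneg (by linarith)
  have hlog : Real.log (1 + y) = 2 * Real.log (u σ) := by
    rw [hy, add_sub_cancel, Real.log_pow, Nat.cast_ofNat]
  have hσy : y - Real.log (1 + y) = σ ^ 2 := by rw [hlog, hy, h2]
  have hsq : (Real.sqrt 2 * σ) ^ 2 = 2 * σ ^ 2 := by
    rw [mul_pow, Real.sq_sqrt zero_le_two]
  rw [← hy]
  refine ⟨max_le ?_ ?_, ?_⟩
  · refine (sq_le_sq₀ (by positivity) hy0).mp ?_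
    linarith [sub_sq_half_le_log_one_add hy0]
  · linarith [Real.log_le_log (by positivity : 0 < 1 + σ ^ 2)
      (by linarith : 1 + σ ^ 2 ≤ 1 + y)]
  · have hL : Real.log (1 + y) ≤ Real.sqrt 2 * σ := by
      refine (sq_le_sq₀ hlog0 (by positivity)).mp ?_
      rw [hsq, ← hσy]
      exact log_one_add_sq_le hy0
    linarith
end

section
/- Let u(σ) ≥ 1 be defined for σ ≥ 0 by u(σ)² − 1 − 2·log u(σ) = σ². Then the function σ ↦ u(σ) is convex on [0, ∞). -/
theorem strictMonoOn_sq_sub_one_sub_two_mul_log :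
    StrictMonoOn (fun t : ℝ => t ^ 2 - 1 - 2 * Real.log t) (Set.Ici 1) := by
  intro a ha b _ hab
  have ha1 : (1 : ℝ) ≤ a := ha
  have ha0 : 0 < a := by linarith
  have hlog : Real.log b - Real.log a ≤ b / a - 1 := by
    rw [← Real.log_div (by linarith) ha0.ne']
    exact Real.log_le_sub_one_of_pos (div_pos (by linarith) ha0)
  have hdiv : b / a - 1 ≤ b - a := by
    rw [div_sub_one ha0.ne']
    exact div_le_self (by linarith) ha1
  simp only
  nlinarith

theorem sq_sub_one_sub_two_mul_log_pos {t : ℝ} (ht : 1 < t) :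
    0 < t ^ 2 - 1 - 2 * Real.log t := by
  simpa using strictMonoOn_sq_sub_one_sub_two_mul_log (Set.self_mem_Ici) ht.le ht

theorem sq_sub_one_le_log_mul {t : ℝ} (ht : 1 ≤ t) :
    t ^ 2 - 1 ≤ Real.log t * (t ^ 2 + 1) := by
  have h := Real.le_log_one_add_of_nonneg (x := t ^ 2 - 1) (by nlinarith)
  rw [add_sub_cancel, Real.log_pow, div_le_iff₀ (by nlinarith)] at h
  push_cast at h
  linarith

theorem concaveOn_sqrt_sq_sub_one_sub_two_mul_log :
    ConcaveOn ℝ (Set.Ici 1) (fun t : ℝ => √(t ^ 2 - 1 - 2 * Real.log t)) := by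
  have hderiv : ∀ t : ℝ, 1 < t → HasDerivAt (fun t : ℝ => √(t ^ 2 - 1 - 2 * Real.log t))
      ((t - t⁻¹) / √(t ^ 2 - 1 - 2 * Real.log t)) t := by
    intro t ht
    have hG : HasDerivAt (fun t : ℝ => t ^ 2 - 1 - 2 * Real.log t) (2 * t - 2 * t⁻¹) t := by
      simpa using ((hasDerivAt_pow 2 t).sub_const 1).fun_sub
        ((Real.hasDerivAt_log (by linarith)).const_mul 2)
    convert hG.sqrt (sq_sub_one_sub_two_mul_log_pos ht).ne' using 1
    rw [← mul_sub, mul_div_mul_left _ _ two_ne_zero]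
  refine concaveOn_of_hasDerivWithinAt2_nonpos (convex_Ici 1)
    (f' := fun t => (t - t⁻¹) / √(t ^ 2 - 1 - 2 * Real.log t))
    (f'' := fun t => ((1 + (t ^ 2)⁻¹) * √(t ^ 2 - 1 - 2 * Real.log t) -
      (t - t⁻¹) * ((t - t⁻¹) / √(t ^ 2 - 1 - 2 * Real.log t))) /
      √(t ^ 2 - 1 - 2 * Real.log t) ^ 2) ?_ ?_ ?_ ?_
  · have : ContinuousOn Real.log (Set.Ici 1) := Real.continuousOn_log.mono fun t ht => by
      have : (1 : ℝ) ≤ t := ht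
      simp only [Set.mem_compl_iff, Set.mem_singleton_iff]
      linarith
    fun_prop
  · intro t ht
    rw [interior_Ici] at ht
    exact (hderiv t ht).hasDerivWithinAt
  · intro t ht
    rw [interior_Ici] at ht
    have ht1 : 1 < t := ht
    have hnum : HasDerivAt (fun t : ℝ => t - t⁻¹) (1 + (t ^ 2)⁻¹) t := by
      simpa using (hasDerivAt_id' t).fun_sub (hasDerivAt_inv (by linarith : t ≠ 0))
    exact (hnum.div (hderiv t ht)
      (Real.sqrt_pos.2 (sq_sub_one_sub_two_mul_log_pos ht)).ne').hasDerivWithinAt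
  · intro t ht
    rw [interior_Ici] at ht
    have ht1 : 1 < t := ht
    have hG := sq_sub_one_sub_two_mul_log_pos ht1
    have hs := Real.sqrt_pos.2 hG
    refine div_nonpos_of_nonpos_of_nonneg ?_ (sq_nonneg _)
    rw [sub_nonpos, ← mul_div_assoc, le_div_iff₀ hs, mul_assoc, Real.mul_self_sqrt hG.le]
    have ht0 : t ≠ 0 := by linarith
    have hlhs : (1 + (t ^ 2)⁻¹) * (t ^ 2 - 1 - 2 * Real.log t) =
        (t ^ 2 + 1) * (t ^ 2 - 1 - 2 * Real.log t) / t ^ 2 := by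
      field_simp
    have hrhs : (t - t⁻¹) * (t - t⁻¹) = (t ^ 2 - 1) ^ 2 / t ^ 2 := by
      field_simp
    rw [hlhs, hrhs]
    gcongr
    nlinarith [sq_sub_one_le_log_mul ht1.le]

/-- The implicit function `u(σ)` defined by `u² − 1 − 2·log u = σ²`, `u ≥ 1`,
is convex on `[0, ∞)`. -/
theorem u_convex
    (u : ℝ → ℝ)
    (hu : ∀ σ : ℝ, 0 ≤ σ →
      1 ≤ u σ ∧ (u σ) ^ 2 - 1 - 2 * Real.log (u σ) = σ ^ 2) :
    ConvexOn ℝ (Set.Ici 0) u := by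
  refine ⟨convex_Ici 0, fun x hx y hy a b ha hb hab => ?_⟩
  have hz : 0 ≤ a • x + b • y := convex_Ici 0 hx hy ha hb hab
  obtain ⟨hux, hx_eq⟩ := hu x hx
  obtain ⟨huy, hy_eq⟩ := hu y hy
  obtain ⟨huz, hz_eq⟩ := hu _ hz
  have hmem : a • u x + b • u y ∈ Set.Ici (1 : ℝ) := convex_Ici 1 hux huy ha hb hab
  have hconc := concaveOn_sqrt_sq_sub_one_sub_two_mul_log.2 hux huy ha hb hab
  simp only [hx_eq, hy_eq, Real.sqrt_sq hx, Real.sqrt_sq hy] at hconc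
  rw [← strictMonoOn_sq_sub_one_sub_two_mul_log.le_iff_le huz hmem]
  simp only [hz_eq]
  refine (Real.le_sqrt hz ?_).1 hconc
  simpa using strictMonoOn_sq_sub_one_sub_two_mul_log.monotoneOn Set.self_mem_Ici hmem hmem
end
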